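/- Let (p_n)_{n≥0} and (q_n)_{n≥0} be sequences of nonnegative real numbers with p₀+q₀≤1, and suppose there exist ε∈(0,1), ℓ∈ℕ with ℓ≥1, C>0 and σ∈(0,1) such that, writing s_n:=p_n+q_n, one has s_n ≤ (1−ε)^ℓ p_{n−ℓ} + q_{n−ℓ} for every n≥ℓ, and q_n ≤ Cσⁿ + Σ_{k=1}^{n} (1−ε)^k p_{n−k} for every n≥1. Then there exist δ∈(0,1) and K>0 such that s_n ≤ K(1−δ)ⁿ for every n∈ℕ; i.e., s_n decays exponentially. -/

import Mathlib

open Set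

/-- The sequence `∑_{k=1}^n r^k f_{n-k}` satisfies a first-order recursion. -/
theorem sum_Icc_pow_mul_sub_succ (r : ℝ) (f : ℕ → ℝ) (n : ℕ) :
    ∑ k ∈ Finset.Icc 1 (n + 1), r ^ k * f (n + 1 - k) =
      r * (f n + ∑ k ∈ Finset.Icc 1 n, r ^ k * f (n - k)) := by
  have shift : ∀ (m : ℕ) (g : ℕ → ℝ),
      ∑ k ∈ Finset.Icc 1 m, g k = ∑ k ∈ Finset.range m, g (k + 1) := by
    intro m g
    rw [Finset.range_eq_Ico, Finset.sum_Ico_add' g 0 m 1]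
    rfl
  rw [shift, shift, Finset.sum_range_succ', add_comm, mul_add, Finset.mul_sum]
  congr 1
  · simp
  · refine Finset.sum_congr rfl fun k _ => ?_
    rw [show n + 1 - (k + 1 + 1) = n - (k + 1) by omega]
    ring

/-- Weighted partial sums of the convolution of `f` with a geometric sequence are controlled by
the weighted partial sums of `f`. -/
theorem one_sub_mul_sum_pow_mul_geom_conv_le {r θ : ℝ} (hr : 0 ≤ r) (hθ : 0 ≤ θ)
    {f : ℕ → ℝ} (hf : ∀ n, 0 ≤ f n) (N : ℕ) :
    (1 - θ * r) * ∑ n ∈ Finset.range N,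
        θ ^ n * ∑ k ∈ Finset.Icc 1 n, r ^ k * f (n - k) ≤
      θ * r * ∑ n ∈ Finset.range N, θ ^ n * f n := by
  set c : ℕ → ℝ := fun n => ∑ k ∈ Finset.Icc 1 n, r ^ k * f (n - k) with hc
  have hc0 : ∀ n, 0 ≤ c n := fun n =>
    Finset.sum_nonneg fun k _ => mul_nonneg (pow_nonneg hr k) (hf _)
  have hrec : ∑ n ∈ Finset.range (N + 1), θ ^ n * c n =
      θ * r * (∑ n ∈ Finset.range N, θ ^ n * f n + ∑ n ∈ Finset.range N, θ ^ n * c n) := by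
    have hc_zero : c 0 = 0 := by simp [hc]
    rw [Finset.sum_range_succ', hc_zero, mul_zero, add_zero, ← Finset.sum_add_distrib,
      Finset.mul_sum]
    refine Finset.sum_congr rfl fun n _ => ?_
    rw [show c (n + 1) = r * (f n + c n) from sum_Icc_pow_mul_sub_succ r f n]
    ring
  have hmono : ∑ n ∈ Finset.range N, θ ^ n * c n ≤ ∑ n ∈ Finset.range (N + 1), θ ^ n * c n := by
    rw [Finset.sum_range_succ]
    exact le_add_of_nonneg_right (mul_nonneg (pow_nonneg hθ N) (hc0 N))
  linarith

/-- Partial sums weighted by `θ ^ n`, for a sequence bounded after a delay `ℓ` by another one. -/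
theorem sum_pow_mul_le_of_delay {θ : ℝ} (hθ : 0 ≤ θ) {f g : ℕ → ℝ} (hf : ∀ n, 0 ≤ f n)
    {ℓ : ℕ} (hfg : ∀ n, f (ℓ + n) ≤ g n) (N : ℕ) :
    ∑ n ∈ Finset.range N, θ ^ n * f n ≤
      ∑ n ∈ Finset.range ℓ, θ ^ n * f n + θ ^ ℓ * ∑ n ∈ Finset.range N, θ ^ n * g n := by
  calc ∑ n ∈ Finset.range N, θ ^ n * f n
      ≤ ∑ n ∈ Finset.range (ℓ + N), θ ^ n * f n :=
        Finset.sum_le_sum_of_subset_of_nonneg (Finset.range_mono (by omega))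
          fun n _ _ => mul_nonneg (pow_nonneg hθ n) (hf n)
    _ ≤ _ := by
        rw [Finset.sum_range_add, Finset.mul_sum]
        refine add_le_add le_rfl (Finset.sum_le_sum fun n _ => ?_)
        rw [pow_add, mul_assoc]
        gcongr
        exact hfg n

/-- A weight `θ > 1` close enough to `1` for the weighted sums to be absorbed. -/
theorem exists_one_lt_weight {r σ a : ℝ} (hr : r < 1) (hσ : σ < 1) (ha : a < 1) (ℓ : ℕ) :
    ∃ θ : ℝ, 1 < θ ∧ θ * r < 1 ∧ θ * σ < 1 ∧
      0 < (1 - θ * r) * (1 - θ ^ ℓ * a) - (θ ^ ℓ - 1) * (θ * r) := by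
  have key : ∀ F : ℝ → ℝ, Continuous F → 0 < F 1 → ∀ᶠ θ in nhdsWithin 1 (Ioi 1), 0 < F θ :=
    fun F hF h => (hF.continuousAt.eventually (lt_mem_nhds h)).filter_mono nhdsWithin_le_nhds
  have e1 := key (fun θ => 1 - θ * r) (by fun_prop) (by simpa using hr)
  have e2 := key (fun θ => 1 - θ * σ) (by fun_prop) (by simpa using hσ)
  have e3 := key (fun θ => (1 - θ * r) * (1 - θ ^ ℓ * a) - (θ ^ ℓ - 1) * (θ * r)) (by fun_prop)
    (by simpa using mul_pos (sub_pos.2 hr) (sub_pos.2 ha))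
  obtain ⟨θ, h1, h2, h3, h4⟩ := (e1.and (e2.and (e3.and self_mem_nhdsWithin))).exists
  exact ⟨θ, h4, sub_pos.1 h1, sub_pos.1 h2, h3⟩

/-- an arithmetic lemma on sequences. Let `(p_n)`, `(q_n)` be sequences of
nonnegative reals with `p₀ + q₀ ≤ 1`, and suppose there are `ε ∈ (0,1)`, `ℓ ≥ 1`, `C > 0`,
`σ ∈ (0,1)` such that, with `s_n := p_n + q_n`,
`s_n ≤ (1-ε)^ℓ p_{n-ℓ} + q_{n-ℓ}` for `n ≥ ℓ`, and
`q_n ≤ C σⁿ + Σ_{k=1}^{n} (1-ε)^k p_{n-k}` for `n ≥ 1`.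
Then `s_n` decays exponentially: `s_n ≤ K (1-δ)ⁿ` for some `δ ∈ (0,1)`, `K > 0`. -/
theorem statement19 (p q : ℕ → ℝ) (hp : ∀ n, 0 ≤ p n) (hq : ∀ n, 0 ≤ q n)
    (h0 : p 0 + q 0 ≤ 1)
    (ε : ℝ) (hε : ε ∈ Ioo (0:ℝ) 1) (ℓ : ℕ) (hℓ : 1 ≤ ℓ)
    (C σ : ℝ) (hC : 0 < C) (hσ : σ ∈ Ioo (0:ℝ) 1)
    (h1 : ∀ n : ℕ, ℓ ≤ n → p n + q n ≤ (1 - ε) ^ ℓ * p (n - ℓ) + q (n - ℓ))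
    (h2 : ∀ n : ℕ, 1 ≤ n →
      q n ≤ C * σ ^ n + ∑ k ∈ Finset.Icc 1 n, (1 - ε) ^ k * p (n - k)) :
    ∃ δ : ℝ, δ ∈ Ioo (0:ℝ) 1 ∧ ∃ K : ℝ, 0 < K ∧
      ∀ n : ℕ, p n + q n ≤ K * (1 - δ) ^ n := by
  obtain ⟨hε0, hε1⟩ := hε
  obtain ⟨hσ0, hσ1⟩ := hσ
  have hr0 : 0 ≤ 1 - ε := by linarith
  have hr1 : 1 - ε < 1 := by linarith
  obtain ⟨θ, hθ, hθr, hθσ, hd⟩ :=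
    exists_one_lt_weight hr1 hσ1 (pow_lt_one₀ hr0 hr1 (by omega : ℓ ≠ 0)) ℓ
  have hθ0 : 0 < θ := one_pos.trans hθ
  set r := 1 - ε
  set t := θ ^ ℓ
  have ht : 0 ≤ t - 1 := sub_nonneg.2 (one_le_pow₀ hθ.le)
  set d := (1 - θ * r) * (1 - t * r ^ ℓ) - (t - 1) * (θ * r)
  set A := ∑ n ∈ Finset.range ℓ, θ ^ n * (p n + q n)
  set B := (C + q 0) * (1 - θ * σ)⁻¹ with hB
  set D := θ * r / (1 - θ * r)
  have hD : 0 ≤ D := div_nonneg (mul_nonneg hθ0.le hr0) (sub_nonneg.2 hθr.le)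
  set M := (1 - θ * r) * (A + (t - 1) * B) / d
  have hbound : ∀ N, ∑ n ∈ Finset.range N, θ ^ n * (p n + q n) ≤ M + (B + D * M) := by
    intro N
    set c : ℕ → ℝ := fun n => ∑ k ∈ Finset.Icc 1 n, r ^ k * p (n - k)
    set P := ∑ n ∈ Finset.range N, θ ^ n * p n with hP
    set Q := ∑ n ∈ Finset.range N, θ ^ n * q n with hQ
    set G := ∑ n ∈ Finset.range N, θ ^ n * c n with hG
    have hPQ : ∑ n ∈ Finset.range N, θ ^ n * (p n + q n) = P + Q := by
      simp only [mul_add, Finset.sum_add_distrib, hP, hQ]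
    have hdelay : P + Q ≤ A + t * (r ^ ℓ * P + Q) := by
      have h := sum_pow_mul_le_of_delay hθ0.le (f := fun n => p n + q n)
        (g := fun n => r ^ ℓ * p n + q n) (fun n => add_nonneg (hp n) (hq n)) (ℓ := ℓ)
        (fun n => by simpa using h1 (ℓ + n) (Nat.le_add_right ℓ n)) N
      rw [hPQ] at h
      convert h using 3
      rw [hP, hQ, Finset.mul_sum, ← Finset.sum_add_distrib]
      exact Finset.sum_congr rfl fun n _ => by ring
    have hqn : ∀ n, q n ≤ (C + q 0) * σ ^ n + c n := by
      intro n
      rcases Nat.eq_zero_or_pos n with rfl | hn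
      · simpa [c] using hC.le
      · have := h2 n hn
        have := mul_nonneg (hq 0) (pow_nonneg hσ0.le n)
        linarith
    have hgeom : ∑ n ∈ Finset.range N, (θ * σ) ^ n ≤ (1 - θ * σ)⁻¹ :=
      sum_le_hasSum _ (fun n _ => by positivity)
        (hasSum_geometric_of_lt_one (by positivity) hθσ)
    have hQle : Q ≤ B + G := by
      calc Q ≤ ∑ n ∈ Finset.range N, θ ^ n * ((C + q 0) * σ ^ n + c n) := by
            rw [hQ]
            gcongr with n
            exact hqn n
        _ = (C + q 0) * ∑ n ∈ Finset.range N, (θ * σ) ^ n + G := by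
            rw [hG, Finset.mul_sum, ← Finset.sum_add_distrib]
            exact Finset.sum_congr rfl fun n _ => by ring
        _ ≤ B + G := by
            rw [hB]
            gcongr
            exact add_nonneg hC.le (hq 0)
    have hGle : (1 - θ * r) * G ≤ θ * r * P :=
      one_sub_mul_sum_pow_mul_geom_conv_le hr0 hθ0.le hp N
    have hGD : G ≤ D * P := by
      rw [div_mul_eq_mul_div, le_div_iff₀ (sub_pos.2 hθr)]
      linarith
    have hPM : P ≤ M := by
      rw [le_div_iff₀ hd]
      have e1 : (1 - t * r ^ ℓ) * P ≤ A + (t - 1) * (B + G) := by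
        have := mul_le_mul_of_nonneg_left hQle ht
        linarith
      have e2 := mul_le_mul_of_nonneg_left e1 (sub_nonneg.2 hθr.le)
      have e3 := mul_le_mul_of_nonneg_left hGle ht
      calc P * d = (1 - θ * r) * ((1 - t * r ^ ℓ) * P) - (t - 1) * (θ * r * P) := by ring
        _ ≤ (1 - θ * r) * (A + (t - 1) * (B + G)) - (t - 1) * ((1 - θ * r) * G) :=
            sub_le_sub e2 e3
        _ = (1 - θ * r) * (A + (t - 1) * B) := by ring
    rw [hPQ]
    have := mul_le_mul_of_nonneg_left hPM hD
    linarith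
  have hK : 0 ≤ M + (B + D * M) := by simpa using hbound 0
  refine ⟨1 - θ⁻¹, ⟨sub_pos.2 (inv_lt_one_of_one_lt₀ hθ), sub_lt_self _ (inv_pos.2 hθ0)⟩,
    M + (B + D * M) + 1, by linarith, fun n => ?_⟩
  rw [sub_sub_cancel, inv_pow, ← div_eq_mul_inv, le_div_iff₀ (pow_pos hθ0 n), mul_comm]
  have hterm := Finset.single_le_sum (f := fun n => θ ^ n * (p n + q n))
    (fun m _ => mul_nonneg (pow_nonneg hθ0.le m) (add_nonneg (hp m) (hq m)))
    (Finset.self_mem_range_succ n)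
  linarith [hbound (n + 1)]
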